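/- (Existence of good typicality families for correlated Gaussian hypothesis testing.) Let K_p, K_q : ℤ → ℝ be even, absolutely summable functions whose spectra S_p(f) = Σ_{m∈ℤ} K_p(m) e^{−2πi f m} and S_q(f) = Σ_{m∈ℤ} K_q(m) e^{−2πi f m} satisfy 0 < c ≤ S_p(f), S_q(f) ≤ M for all f ∈ [0,1], and assume S_p is not identically equal to S_q. Let p^{(n)} = N(0, Λ_p^{(n)}) and q^{(n)} = N(0, Λ_q^{(n)}) be the centered Gaussian measures on ℝⁿ with Toeplitz covariances Λ_p^{(n)}_{ij} = K_p(i−j), Λ_q^{(n)}_{ij} = K_q(i−j), and let D_n = ∫ ln(dp^{(n)}/dq^{(n)}) dp^{(n)} be their relative entropy (in nats). Then for every sequence of positive reals (δ_n) with δ_n/√n → ∞, p^{(n)}( { x ∈ ℝⁿ : | ln( (dp^{(n)}/dq^{(n)})(x) ) − D_n | ≤ δ_n } ) → 1 as n → ∞. -/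

import Mathlib

open MeasureTheory Filter Matrix

/-- The spectrum `S(f) = Σ_{m ∈ ℤ} K(m) e^{-2πi f m}` of an even, absolutely summable
auto-covariance function `K : ℤ → ℝ`; by evenness it equals the real cosine series. -/
noncomputable def spectrum' (K : ℤ → ℝ) (f : ℝ) : ℝ :=
  ∑' m : ℤ, K m * Real.cos (2 * Real.pi * f * (m : ℝ))

/-- The `n × n` symmetric Toeplitz matrix with entries `K(i - j)`. -/
def toeplitz (K : ℤ → ℝ) (n : ℕ) : Matrix (Fin n) (Fin n) ℝ :=
  fun i j => K ((i : ℤ) - (j : ℤ))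

/-- The density of the centered multivariate Gaussian `N(0, Λ)` on `ℝⁿ`. -/
noncomputable def gaussianPdf (n : ℕ) (Λ : Matrix (Fin n) (Fin n) ℝ) (x : Fin n → ℝ) : ℝ :=
  (Real.sqrt ((2 * Real.pi) ^ n * Λ.det))⁻¹ * Real.exp (-(x ⬝ᵥ (Λ⁻¹ *ᵥ x)) / 2)

/-- The centered multivariate Gaussian measure `N(0, Λ)` on `ℝⁿ`. -/
noncomputable def gaussianMeasure (n : ℕ) (Λ : Matrix (Fin n) (Fin n) ℝ) :
    Measure (Fin n → ℝ) :=
  volume.withDensity fun x => ENNReal.ofReal (gaussianPdf n Λ x)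


open ProbabilityTheory

section Toeplitz

lemma continuous_spectrum' {K : ℤ → ℝ} (hK : Summable fun m : ℤ => |K m|) :
    Continuous (spectrum' K) := by
  refine continuous_tsum (u := fun m => |K m|) (fun m => by fun_prop) hK fun m x => ?_
  rw [Real.norm_eq_abs, abs_mul]
  exact mul_le_of_le_one_right (abs_nonneg _) (Real.abs_cos_le_one _)

lemma integral_cos_two_pi_mul_int (m : ℤ) :
    ∫ f in (0 : ℝ)..1, Real.cos (2 * Real.pi * f * m) = if m = 0 then 1 else 0 := by
  split_ifs with h
  · simp [h]
  · have hm : (2 * Real.pi * m : ℝ) ≠ 0 := by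
      have : (m : ℝ) ≠ 0 := by exact_mod_cast h
      positivity
    have : (fun f : ℝ => Real.cos (2 * Real.pi * f * m))
        = fun f => Real.cos ((2 * Real.pi * m) * f) := by
      ext f; ring_nf
    rw [this, intervalIntegral.integral_comp_mul_left _ hm, integral_cos]
    have h2 : Real.sin (2 * Real.pi * m * 1) = 0 := by
      rw [mul_one, mul_comm]
      have := Real.sin_int_mul_pi (2 * m)
      push_cast at this
      rw [← this]; ring_nf
    rw [h2]; simp

/-- Fourier inversion for the spectrum of an even summable sequence. -/
lemma integral_spectrum'_mul_cos {K : ℤ → ℝ} (hK : Summable fun m : ℤ => |K m|)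
    (heven : ∀ m, K (-m) = K m) (k : ℤ) :
    ∫ f in (0 : ℝ)..1, spectrum' K f * Real.cos (2 * Real.pi * f * k) = K k := by
  have hprod (m : ℤ) (f : ℝ) : Real.cos (2 * Real.pi * f * m) * Real.cos (2 * Real.pi * f * k)
      = (Real.cos (2 * Real.pi * f * ((m - k : ℤ) : ℝ))
        + Real.cos (2 * Real.pi * f * ((m + k : ℤ) : ℝ))) / 2 := by
    push_cast
    rw [mul_sub, mul_add, Real.cos_sub, Real.cos_add]
    ring
  have hterm (m : ℤ) : ∫ f in (0 : ℝ)..1,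
      K m * Real.cos (2 * Real.pi * f * m) * Real.cos (2 * Real.pi * f * k)
      = (if m = k then K k / 2 else 0) + (if m = -k then K k / 2 else 0) := by
    simp_rw [mul_assoc (K m), hprod]
    rw [intervalIntegral.integral_const_mul, intervalIntegral.integral_div,
      intervalIntegral.integral_add (Continuous.intervalIntegrable (by fun_prop) _ _)
        (Continuous.intervalIntegrable (by fun_prop) _ _),
      integral_cos_two_pi_mul_int, integral_cos_two_pi_mul_int]
    simp only [sub_eq_zero, add_eq_zero_iff_eq_neg]
    split_ifs with h1 h2 h2
    · subst h1; ring
    · subst h1; ring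
    · subst h2; rw [heven]; ring
    · ring
  have hsum := intervalIntegral.hasSum_integral_of_dominated_convergence
    (μ := volume) (a := 0) (b := 1)
    (F := fun (m : ℤ) (f : ℝ) =>
      K m * Real.cos (2 * Real.pi * f * m) * Real.cos (2 * Real.pi * f * k))
    (f := fun f => spectrum' K f * Real.cos (2 * Real.pi * f * k))
    (fun m _ => |K m|)
    (fun m => (by fun_prop : Continuous _).aestronglyMeasurable)
    (fun m => ae_of_all _ fun f _ => by
      rw [Real.norm_eq_abs, abs_mul, abs_mul, mul_assoc]
      exact mul_le_of_le_one_right (abs_nonneg _)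
        (mul_le_one₀ (Real.abs_cos_le_one _) (abs_nonneg _) (Real.abs_cos_le_one _)))
    (ae_of_all _ fun f _ => hK)
    (by simp)
    (ae_of_all _ fun f _ => by
      refine HasSum.mul_right _ (Summable.hasSum ?_)
      refine Summable.of_norm_bounded hK fun m => ?_
      rw [Real.norm_eq_abs, abs_mul]
      exact mul_le_of_le_one_right (abs_nonneg _) (Real.abs_cos_le_one _))
  simp_rw [hterm] at hsum
  rw [← hsum.tsum_eq]
  have := ((hasSum_ite_eq k (K k / 2)).add (hasSum_ite_eq (-k) (K k / 2))).tsum_eq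
  rw [this]
  ring

/-- The squared modulus of the trigonometric polynomial with coefficients `x`. -/
noncomputable def trigEnergy {n : ℕ} (x : Fin n → ℝ) (f : ℝ) : ℝ :=
  (∑ i, x i * Real.cos (2 * Real.pi * f * (i : ℕ))) ^ 2
    + (∑ i, x i * Real.sin (2 * Real.pi * f * (i : ℕ))) ^ 2

lemma trigEnergy_nonneg {n : ℕ} (x : Fin n → ℝ) (f : ℝ) : 0 ≤ trigEnergy x f := by
  unfold trigEnergy; positivity

lemma continuous_trigEnergy {n : ℕ} (x : Fin n → ℝ) : Continuous (trigEnergy x) := by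
  unfold trigEnergy; fun_prop

lemma dotProduct_toeplitz_mulVec {K : ℤ → ℝ} (hK : Summable fun m : ℤ => |K m|)
    (heven : ∀ m, K (-m) = K m) {n : ℕ} (x : Fin n → ℝ) :
    x ⬝ᵥ toeplitz K n *ᵥ x = ∫ f in (0 : ℝ)..1, spectrum' K f * trigEnergy x f := by
  have hexp (f : ℝ) : spectrum' K f * trigEnergy x f = ∑ i, ∑ j, x i * x j *
      (spectrum' K f * Real.cos (2 * Real.pi * f * (((i : ℤ) - (j : ℤ) : ℤ) : ℝ))) := by
    rw [trigEnergy, sq, sq, Finset.sum_mul_sum, Finset.sum_mul_sum, ← Finset.sum_add_distrib,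
      Finset.mul_sum]
    refine Finset.sum_congr rfl fun i _ => ?_
    rw [← Finset.sum_add_distrib, Finset.mul_sum]
    refine Finset.sum_congr rfl fun j _ => ?_
    push_cast
    rw [mul_sub, Real.cos_sub]
    ring
  have hS := continuous_spectrum' hK
  simp_rw [hexp]
  rw [intervalIntegral.integral_finsetSum
    fun i _ => Continuous.intervalIntegrable (by fun_prop) _ _]
  simp only [dotProduct, mulVec, Finset.mul_sum]
  refine Finset.sum_congr rfl fun i _ => ?_
  rw [intervalIntegral.integral_finsetSum
    fun i _ => Continuous.intervalIntegrable (by fun_prop) _ _]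
  refine Finset.sum_congr rfl fun j _ => ?_
  rw [intervalIntegral.integral_const_mul, integral_spectrum'_mul_cos hK heven, toeplitz]
  ring

/-- Parseval's identity. -/
lemma integral_trigEnergy {n : ℕ} (x : Fin n → ℝ) :
    ∫ f in (0 : ℝ)..1, trigEnergy x f = x ⬝ᵥ x := by
  let K : ℤ → ℝ := Pi.single 0 1
  have hK : Summable fun m : ℤ => |K m| :=
    summable_of_ne_finset_zero (s := {0}) fun m hm => by
      simp [K, Pi.single_eq_of_ne (Finset.notMem_singleton.1 hm)]
  have heven (m : ℤ) : K (-m) = K m := by simp [K, Pi.single_apply]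
  have hspec (f : ℝ) : spectrum' K f = 1 := by
    rw [spectrum', tsum_eq_single 0 fun m hm => by simp [K, Pi.single_eq_of_ne hm]]
    simp [K]
  have htoep : toeplitz K n = 1 := by
    ext i j
    simp [toeplitz, K, Pi.single_apply, Matrix.one_apply, sub_eq_zero, Fin.ext_iff]
  have := dotProduct_toeplitz_mulVec hK heven x
  simpa [hspec, htoep] using this.symm

lemma dotProduct_toeplitz_mulVec_mem_Icc {K : ℤ → ℝ} (hK : Summable fun m : ℤ => |K m|)
    (heven : ∀ m, K (-m) = K m) {c M : ℝ}
    (hS : ∀ f ∈ Set.Icc (0 : ℝ) 1, c ≤ spectrum' K f ∧ spectrum' K f ≤ M)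
    {n : ℕ} (x : Fin n → ℝ) :
    c * (x ⬝ᵥ x) ≤ x ⬝ᵥ toeplitz K n *ᵥ x ∧ x ⬝ᵥ toeplitz K n *ᵥ x ≤ M * (x ⬝ᵥ x) := by
  have hT := continuous_trigEnergy x
  have hSc := continuous_spectrum' hK
  rw [dotProduct_toeplitz_mulVec hK heven, ← integral_trigEnergy,
    ← intervalIntegral.integral_const_mul, ← intervalIntegral.integral_const_mul]
  constructor <;>
  refine intervalIntegral.integral_mono_on zero_le_one
    (Continuous.intervalIntegrable (by fun_prop) _ _)
    (Continuous.intervalIntegrable (by fun_prop) _ _) fun f hf => ?_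
  · exact mul_le_mul_of_nonneg_right (hS f hf).1 (trigEnergy_nonneg x f)
  · exact mul_le_mul_of_nonneg_right (hS f hf).2 (trigEnergy_nonneg x f)

lemma toeplitz_isSymm {K : ℤ → ℝ} (heven : ∀ m, K (-m) = K m) (n : ℕ) :
    (toeplitz K n).IsSymm := by
  ext i j
  simp only [transpose_apply, toeplitz]
  rw [← heven, neg_sub]

end Toeplitz

section Diagonalization

variable {n : ℕ}

lemma dotProduct_mul_mul_transpose_mulVec (T D : Matrix (Fin n) (Fin n) ℝ) (w : Fin n → ℝ) :
    w ⬝ᵥ (T * D * Tᵀ) *ᵥ w = (Tᵀ *ᵥ w) ⬝ᵥ D *ᵥ (Tᵀ *ᵥ w) := by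
  rw [← mulVec_mulVec, ← mulVec_mulVec, dotProduct_mulVec, ← mulVec_transpose]

lemma Matrix.IsSymm.exists_orthogonal_diagonal {A : Matrix (Fin n) (Fin n) ℝ} (hA : A.IsSymm) :
    ∃ (U : Matrix (Fin n) (Fin n) ℝ) (d : Fin n → ℝ), U * Uᵀ = 1 ∧ A = U * diagonal d * Uᵀ := by
  have hH : A.IsHermitian := by
    rw [Matrix.IsHermitian, conjTranspose_eq_transpose_of_trivial]; exact hA
  refine ⟨hH.eigenvectorUnitary, hH.eigenvalues, ?_, ?_⟩
  · exact Unitary.coe_mul_star_self hH.eigenvectorUnitary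
  · have := hH.spectral_theorem
    rw [Unitary.conjStarAlgAut_apply, star_eq_conjTranspose,
      conjTranspose_eq_transpose_of_trivial] at this
    exact this

lemma le_eigenvalue_of_le_dotProduct {T : Matrix (Fin n) (Fin n) ℝ} {d : Fin n → ℝ}
    (hT : IsUnit T.det) {a : ℝ}
    (h : ∀ w, a * (w ⬝ᵥ (T * Tᵀ) *ᵥ w) ≤ w ⬝ᵥ (T * diagonal d * Tᵀ) *ᵥ w) (i : Fin n) :
    a ≤ d i := by
  have hTt : IsUnit Tᵀ.det := by rwa [det_transpose]
  have hw : Tᵀ *ᵥ (Tᵀ⁻¹ *ᵥ Pi.single i 1) = Pi.single i 1 := by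
    rw [mulVec_mulVec, mul_nonsing_inv _ hTt, one_mulVec]
  have := h (Tᵀ⁻¹ *ᵥ Pi.single i 1)
  have h1 := dotProduct_mul_mul_transpose_mulVec T 1 (Tᵀ⁻¹ *ᵥ Pi.single i 1)
  rw [mul_one] at h1
  rw [h1, dotProduct_mul_mul_transpose_mulVec, hw] at this
  simpa [mulVec_diagonal] using this

/-- Simultaneous diagonalization by congruence of two positive definite forms. -/
lemma exists_simultaneous_diagonal {A B : Matrix (Fin n) (Fin n) ℝ} (hA : A.IsSymm)
    (hB : B.IsSymm) {c M : ℝ} (hc : 0 < c) (hM : 0 < M)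
    (hAc : ∀ x, c * (x ⬝ᵥ x) ≤ x ⬝ᵥ A *ᵥ x) (hAM : ∀ x, x ⬝ᵥ A *ᵥ x ≤ M * (x ⬝ᵥ x))
    (hBc : ∀ x, c * (x ⬝ᵥ x) ≤ x ⬝ᵥ B *ᵥ x) :
    ∃ (T : Matrix (Fin n) (Fin n) ℝ) (e : Fin n → ℝ), T.det ≠ 0 ∧ A = T * Tᵀ ∧
      B = T * diagonal e * Tᵀ ∧ ∀ i, c / M ≤ e i := by
  obtain ⟨V, d, hV, rfl⟩ := hA.exists_orthogonal_diagonal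
  have hVdet : IsUnit V.det := (isUnit_iff_isUnit_det V).1 (IsUnit.of_mul_eq_one _ hV)
  have hd (i) : 0 < d i := lt_of_lt_of_le hc <|
    le_eigenvalue_of_le_dotProduct hVdet (by simpa [hV] using hAc) i
  set S := V * diagonal (fun i => √(d i)) with hS
  have hSdet : IsUnit S.det := by
    rw [hS, det_mul, det_diagonal]
    refine hVdet.mul (isUnit_iff_ne_zero.2 (Finset.prod_ne_zero_iff.2 fun i _ => ?_))
    exact (Real.sqrt_pos.2 (hd i)).ne'
  have hAS : V * diagonal d * Vᵀ = S * Sᵀ := by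
    have : diagonal d = diagonal (fun i => √(d i)) * diagonal (fun i => √(d i)) := by
      rw [diagonal_mul_diagonal]
      congr 1; ext i; exact (Real.mul_self_sqrt (hd i).le).symm
    rw [hS, transpose_mul, diagonal_transpose, this]
    simp only [Matrix.mul_assoc]
  have hX : (S⁻¹ * B * S⁻¹ᵀ).IsSymm := by
    rw [Matrix.IsSymm, transpose_mul, transpose_mul, transpose_transpose, hB.eq, Matrix.mul_assoc]
  obtain ⟨U, e, hU, hXe⟩ := hX.exists_orthogonal_diagonal
  have hUdet : IsUnit U.det := (isUnit_iff_isUnit_det U).1 (IsUnit.of_mul_eq_one _ hU)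
  have hTdet : IsUnit (S * U).det := by rw [det_mul]; exact hSdet.mul hUdet
  have hAT : S * Sᵀ = (S * U) * (S * U)ᵀ := by
    rw [transpose_mul S U, Matrix.mul_assoc S, ← Matrix.mul_assoc U, hU, Matrix.one_mul]
  have hBT : B = (S * U) * diagonal e * (S * U)ᵀ := by
    have h1 : (S * U) * diagonal e * (S * U)ᵀ = S * (U * diagonal e * Uᵀ) * Sᵀ := by
      rw [transpose_mul]; simp only [Matrix.mul_assoc]
    have hSt : S⁻¹ᵀ * Sᵀ = 1 := by
      rw [← transpose_mul, mul_nonsing_inv _ hSdet, transpose_one]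
    rw [h1, ← hXe]
    calc B = (S * S⁻¹) * B * (S⁻¹ᵀ * Sᵀ) := by
          rw [hSt, mul_nonsing_inv _ hSdet, Matrix.one_mul, Matrix.mul_one]
      _ = _ := by simp only [Matrix.mul_assoc]
  refine ⟨S * U, e, hTdet.ne_zero, hAS.trans hAT, hBT, ?_⟩
  refine le_eigenvalue_of_le_dotProduct hTdet fun w => ?_
  rw [← hAT, ← hBT, ← hAS]
  refine le_trans ?_ (hBc w)
  calc c / M * _ ≤ c / M * (M * (w ⬝ᵥ w)) := by gcongr; exact hAM w
    _ = c * (w ⬝ᵥ w) := by field_simp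

end Diagonalization

section Gaussian

variable {n : ℕ}

lemma continuous_gaussianPdf (A : Matrix (Fin n) (Fin n) ℝ) : Continuous (gaussianPdf n A) := by
  unfold gaussianPdf
  fun_prop

lemma gaussianPdf_pos {A : Matrix (Fin n) (Fin n) ℝ} (hA : 0 < A.det) (x : Fin n → ℝ) :
    0 < gaussianPdf n A x := by
  unfold gaussianPdf
  positivity

lemma gaussianPdf_one (x : Fin n → ℝ) :
    gaussianPdf n 1 x = ∏ i, gaussianPDFReal 0 1 (x i) := by
  simp only [gaussianPdf, gaussianPDFReal, det_one, mul_one, inv_one, one_mulVec, sub_zero,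
    NNReal.coe_one, Finset.prod_mul_distrib, Finset.prod_const, Finset.card_univ,
    Fintype.card_fin, ← Real.exp_sum, dotProduct]
  rw [← Finset.sum_div, Finset.sum_neg_distrib, inv_pow]
  congr 2
  · rw [Real.sqrt_eq_iff_mul_self_eq (by positivity) (by positivity), ← mul_pow,
      Real.mul_self_sqrt (by positivity)]
  · simp only [← sq]

lemma gaussianMeasure_one :
    gaussianMeasure n 1 = Measure.pi fun _ : Fin n => gaussianReal 0 1 := by
  symm
  refine Measure.pi_eq fun s hs => ?_
  rw [gaussianMeasure, withDensity_apply _ (MeasurableSet.univ_pi hs), volume_pi,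
    Measure.restrict_pi_pi]
  simp_rw [gaussianPdf_one]
  have hint : Integrable (fun x : Fin n → ℝ => ∏ i, gaussianPDFReal 0 1 (x i))
      (Measure.pi fun i => volume.restrict (s i)) :=
    Integrable.fintype_prod fun i => (integrable_gaussianPDFReal 0 1).restrict
  rw [← ofReal_integral_eq_lintegral_ofReal hint
    (ae_of_all _ fun x => Finset.prod_nonneg fun i _ => gaussianPDFReal_nonneg _ _ _),
    integral_fintype_prod_eq_prod (fun _ => gaussianPDFReal 0 1),
    ENNReal.ofReal_prod_of_nonneg
      fun i _ => integral_nonneg fun x => gaussianPDFReal_nonneg _ _ _]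
  exact Finset.prod_congr rfl fun i _ =>
    (gaussianReal_apply_eq_integral 0 one_ne_zero (s i)).symm

lemma dotProduct_inv_mulVec {T : Matrix (Fin n) (Fin n) ℝ} (hT : T.det ≠ 0)
    (D : Matrix (Fin n) (Fin n) ℝ) (z : Fin n → ℝ) :
    (T *ᵥ z) ⬝ᵥ ((T * D * Tᵀ)⁻¹ *ᵥ (T *ᵥ z)) = z ⬝ᵥ D⁻¹ *ᵥ z := by
  have hTu : IsUnit T.det := isUnit_iff_ne_zero.2 hT
  have hTt : IsUnit Tᵀ.det := by rwa [det_transpose]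
  have h : Tᵀ * ((T * D * Tᵀ)⁻¹ * T) = D⁻¹ := by
    rw [Matrix.mul_inv_rev, Matrix.mul_inv_rev, Matrix.mul_assoc, Matrix.mul_assoc, nonsing_inv_mul _ hTu,
      Matrix.mul_one, ← Matrix.mul_assoc, mul_nonsing_inv _ hTt, Matrix.one_mul]
  rw [← h, ← mulVec_mulVec, ← mulVec_mulVec, dotProduct_mulVec z Tᵀ, vecMul_transpose]

lemma gaussianPdf_mulVec {T : Matrix (Fin n) (Fin n) ℝ} (hT : T.det ≠ 0)
    (D : Matrix (Fin n) (Fin n) ℝ) (z : Fin n → ℝ) :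
    gaussianPdf n (T * D * Tᵀ) (T *ᵥ z) =
      |T.det|⁻¹ * gaussianPdf n D z := by
  rw [gaussianPdf, dotProduct_inv_mulVec hT, gaussianPdf, ← mul_assoc]
  congr 1
  rw [det_mul, det_mul, det_transpose, ← mul_inv]
  congr 1
  rw [show (2 * Real.pi) ^ n * (T.det * D.det * T.det)
    = T.det ^ 2 * ((2 * Real.pi) ^ n * D.det) by ring, Real.sqrt_mul (sq_nonneg _),
    Real.sqrt_sq_eq_abs]

/-- A centered Gaussian is the image of the standard one under a square root of its covariance. -/
lemma map_mulVec_pi_gaussianReal {T : Matrix (Fin n) (Fin n) ℝ} (hT : T.det ≠ 0) :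
    (Measure.pi fun _ : Fin n => gaussianReal 0 1).map (fun z => T *ᵥ z)
      = gaussianMeasure n (T * Tᵀ) := by
  have hmeas : Measurable fun z : Fin n → ℝ => T *ᵥ z :=
    (by fun_prop : Continuous fun z : Fin n → ℝ => T *ᵥ z).measurable
  have hpdf : Measurable fun x => ENNReal.ofReal (gaussianPdf n (T * Tᵀ) x) :=
    (continuous_gaussianPdf _).measurable.ennreal_ofReal
  have hvol : (volume : Measure (Fin n → ℝ)).map (fun z => T *ᵥ z)
      = ENNReal.ofReal |T.det⁻¹| • volume := Real.map_matrix_volume_pi_eq_smul_volume_pi hT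
  rw [← gaussianMeasure_one]
  ext s hs
  rw [Measure.map_apply hmeas hs, gaussianMeasure, gaussianMeasure,
    withDensity_apply _ (hmeas hs), withDensity_apply _ hs]
  have hz (z : Fin n → ℝ) : ENNReal.ofReal (gaussianPdf n 1 z)
      = ENNReal.ofReal |T.det| * ENNReal.ofReal (gaussianPdf n (T * Tᵀ) (T *ᵥ z)) := by
    have := gaussianPdf_mulVec hT 1 z
    rw [mul_one] at this
    rw [← ENNReal.ofReal_mul (abs_nonneg _), this, mul_inv_cancel_left₀ (abs_ne_zero.2 hT)]
  simp_rw [hz]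
  rw [lintegral_const_mul' _ _ ENNReal.ofReal_ne_top, ← setLIntegral_map hs hpdf hmeas, hvol,
    Measure.restrict_smul, lintegral_smul_measure, smul_eq_mul, ← mul_assoc,
    ← ENNReal.ofReal_mul (abs_nonneg _), ← abs_mul, mul_inv_cancel₀ hT]
  simp

lemma log_rnDeriv_gaussianMeasure {A B : Matrix (Fin n) (Fin n) ℝ} (hA : 0 < A.det)
    (hB : 0 < B.det) :
    (fun x => Real.log ((gaussianMeasure n A).rnDeriv (gaussianMeasure n B) x).toReal)
      =ᵐ[volume] fun x => Real.log (gaussianPdf n A x) - Real.log (gaussianPdf n B x) := by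
  have hmA := (continuous_gaussianPdf A).measurable
  have hmB := (continuous_gaussianPdf B).measurable
  have : SigmaFinite (gaussianMeasure n A) := by
    unfold gaussianMeasure
    exact SigmaFinite.withDensity_ofReal _
  have h1 := Measure.rnDeriv_withDensity_right (f := fun x => ENNReal.ofReal (gaussianPdf n B x))
    (gaussianMeasure n A) volume hmB.ennreal_ofReal.aemeasurable
    (ae_of_all _ fun x => (ENNReal.ofReal_pos.2 (gaussianPdf_pos hB x)).ne')
    (ae_of_all _ fun x => ENNReal.ofReal_ne_top)
  have h2 := Measure.rnDeriv_withDensity (volume : Measure (Fin n → ℝ)) hmA.ennreal_ofReal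
  filter_upwards [h1, h2] with x hx1 hx2
  rw [gaussianMeasure.eq_def n B, hx1, gaussianMeasure, hx2, ENNReal.toReal_mul,
    ENNReal.toReal_inv, ENNReal.toReal_ofReal (gaussianPdf_pos hA x).le,
    ENNReal.toReal_ofReal (gaussianPdf_pos hB x).le,
    Real.log_mul (inv_ne_zero (gaussianPdf_pos hB x).ne') (gaussianPdf_pos hA x).ne', Real.log_inv]
  ring

lemma log_gaussianPdf {A : Matrix (Fin n) (Fin n) ℝ} (hA : 0 < A.det) (x : Fin n → ℝ) :
    Real.log (gaussianPdf n A x)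
      = -Real.log (√((2 * Real.pi) ^ n * A.det)) - (x ⬝ᵥ (A⁻¹ *ᵥ x)) / 2 := by
  rw [gaussianPdf, Real.log_mul (by positivity) (Real.exp_pos _).ne', Real.log_exp, Real.log_inv]
  ring

/-- In coordinates simultaneously diagonalizing the covariances, the log-likelihood ratio is a
diagonal quadratic form in independent standard Gaussians. -/
lemma exists_log_rnDeriv_mulVec_eq {T : Matrix (Fin n) (Fin n) ℝ} (hT : T.det ≠ 0)
    {e : Fin n → ℝ} (he : ∀ i, 0 < e i) :
    ∃ C : ℝ, (fun z => Real.log ((gaussianMeasure n (T * Tᵀ)).rnDeriv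
        (gaussianMeasure n (T * diagonal e * Tᵀ)) (T *ᵥ z)).toReal)
      =ᵐ[Measure.pi fun _ : Fin n => gaussianReal 0 1]
        fun z => C + ∑ i, ((e i)⁻¹ - 1) / 2 * z i ^ 2 := by
  have hA : 0 < (T * Tᵀ).det := by
    rw [det_mul, det_transpose]; exact mul_self_pos.2 hT
  have hB : 0 < (T * diagonal e * Tᵀ).det := by
    rw [det_mul, det_mul, det_transpose, det_diagonal, mul_right_comm]
    exact mul_pos (mul_self_pos.2 hT) (Finset.prod_pos fun i _ => he i)
  have hinv : (diagonal e)⁻¹ = diagonal fun i => (e i)⁻¹ := by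
    refine inv_eq_right_inv ?_
    rw [diagonal_mul_diagonal, ← diagonal_one]
    congr 1; ext i; exact mul_inv_cancel₀ (he i).ne'
  have hac : gaussianMeasure n (T * Tᵀ) ≪ volume := withDensity_absolutelyContinuous _ _
  have hae := hac.ae_eq (log_rnDeriv_gaussianMeasure hA hB)
  rw [← map_mulVec_pi_gaussianReal hT] at hae ⊢
  have hae' := ae_of_ae_map
    (by fun_prop : Continuous fun z : Fin n → ℝ => T *ᵥ z).aemeasurable hae
  refine ⟨-Real.log (√((2 * Real.pi) ^ n * (T * Tᵀ).det))
    + Real.log (√((2 * Real.pi) ^ n * (T * diagonal e * Tᵀ).det)), ?_⟩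
  filter_upwards [hae'] with z hz
  rw [hz, log_gaussianPdf hA, log_gaussianPdf hB, dotProduct_inv_mulVec hT, hinv]
  have h1 := dotProduct_inv_mulVec hT 1 z
  rw [mul_one, inv_one, one_mulVec] at h1
  rw [h1]
  have hsum : ∑ i, ((e i)⁻¹ - 1) / 2 * z i ^ 2
      = (∑ i, z i * ((e i)⁻¹ * z i)) / 2 - (∑ i, z i * z i) / 2 := by
    rw [Finset.sum_div, Finset.sum_div, ← Finset.sum_sub_distrib]
    exact Finset.sum_congr rfl fun i _ => by ring
  simp only [hsum, dotProduct, mulVec_diagonal]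
  ring

end Gaussian

section Concentration

lemma memLp_two_sq_gaussianReal : MemLp (fun x : ℝ => x ^ 2) 2 (gaussianReal 0 1) := by
  refine (memLp_two_iff_integrable_sq (by fun_prop)).2 ?_
  have h := (memLp_id_gaussianReal (μ := 0) (v := 1) 4).integrable_norm_pow (by norm_num)
  refine h.congr (ae_of_all _ fun x => ?_)
  norm_num [← pow_mul, Even.pow_abs]

lemma variance_const_add_sum_sq_le {n : ℕ} (C : ℝ) {a : Fin n → ℝ} {b : ℝ}
    (ha : ∀ i, |a i| ≤ b) :
    MemLp (fun z => C + ∑ i, a i * z i ^ 2) 2 (Measure.pi fun _ : Fin n => gaussianReal 0 1) ∧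
    Var[fun z => C + ∑ i, a i * z i ^ 2; Measure.pi fun _ : Fin n => gaussianReal 0 1]
      ≤ n * (b ^ 2 * Var[fun x : ℝ => x ^ 2; gaussianReal 0 1]) := by
  have hterm (i : Fin n) : MemLp (fun x : ℝ => a i * x ^ 2) 2 (gaussianReal 0 1) :=
    memLp_two_sq_gaussianReal.const_mul _
  have hsum : MemLp (fun z => ∑ i, a i * z i ^ 2) 2
      (Measure.pi fun _ : Fin n => gaussianReal 0 1) :=
    memLp_finsetSum _ fun i _ => (hterm i).comp_measurePreserving
      (measurePreserving_eval (fun _ : Fin n => gaussianReal 0 1) i)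
  refine ⟨(memLp_const C).add hsum, ?_⟩
  rw [variance_const_add hsum.aestronglyMeasurable]
  have heq : (fun z : Fin n → ℝ => ∑ i, a i * z i ^ 2)
      = ∑ i, fun z : Fin n → ℝ => (fun x : ℝ => a i * x ^ 2) (z i) := by
    ext z; simp
  rw [heq, variance_sum_pi hterm]
  simp_rw [variance_const_mul]
  calc _ ≤ ∑ _i : Fin n, b ^ 2 * Var[fun x : ℝ => x ^ 2; gaussianReal 0 1] := by
        refine Finset.sum_le_sum fun i _ => mul_le_mul_of_nonneg_right ?_ (variance_nonneg _ _)
        exact sq_le_sq.2 ((ha i).trans (le_abs_self b))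
    _ = _ := by simp

/-- Chebyshev's inequality for the log-likelihood ratio of two Gaussian measures. -/
lemma measure_abs_log_rnDeriv_sub_integral_le {n : ℕ} {A B : Matrix (Fin n) (Fin n) ℝ}
    (hA : A.IsSymm) (hB : B.IsSymm) {c M : ℝ} (hc : 0 < c) (hM : 0 < M)
    (hAc : ∀ x, c * (x ⬝ᵥ x) ≤ x ⬝ᵥ A *ᵥ x) (hAM : ∀ x, x ⬝ᵥ A *ᵥ x ≤ M * (x ⬝ᵥ x))
    (hBc : ∀ x, c * (x ⬝ᵥ x) ≤ x ⬝ᵥ B *ᵥ x) {δ : ℝ} (hδ : 0 < δ) :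
    let L := fun x =>
      Real.log ((gaussianMeasure n A).rnDeriv (gaussianMeasure n B) x).toReal
    1 - n * ((M / c + 1) ^ 2 * Var[fun x : ℝ => x ^ 2; gaussianReal 0 1]) / δ ^ 2 ≤
      ((gaussianMeasure n A) {x | |L x - ∫ y, L y ∂(gaussianMeasure n A)| ≤ δ}).toReal ∧
    ((gaussianMeasure n A) {x | |L x - ∫ y, L y ∂(gaussianMeasure n A)| ≤ δ}).toReal ≤ 1 := by
  intro L
  have hL : Measurable L :=
    Real.measurable_log.comp (Measure.measurable_rnDeriv _ _).ennreal_toReal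
  obtain ⟨T, e, hT, hAT, hBT, he⟩ := exists_simultaneous_diagonal hA hB hc hM hAc hAM hBc
  have he0 (i) : 0 < e i := (div_pos hc hM).trans_le (he i)
  obtain ⟨C, hC⟩ := exists_log_rnDeriv_mulVec_eq hT he0
  rw [← hAT, ← hBT] at hC
  have hmap := map_mulVec_pi_gaussianReal hT
  rw [← hAT] at hmap
  have hTm : Measurable fun z : Fin n → ℝ => T *ᵥ z :=
    (by fun_prop : Continuous fun z : Fin n → ℝ => T *ᵥ z).measurable
  have hprob : IsProbabilityMeasure (gaussianMeasure n A) :=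
    hmap ▸ Measure.isProbabilityMeasure_map hTm.aemeasurable
  have ha (i) : |((e i)⁻¹ - 1) / 2| ≤ M / c + 1 := by
    have h1 : (e i)⁻¹ ≤ M / c := by
      rw [← inv_div]; exact inv_anti₀ (div_pos hc hM) (he i)
    have h2 : 0 < (e i)⁻¹ := inv_pos.2 (he0 i)
    rw [abs_le]
    constructor <;> linarith
  obtain ⟨hLp, hvar⟩ := variance_const_add_sum_sq_le C ha
  have hLp' : MemLp L 2 (gaussianMeasure n A) := by
    rw [← hmap, memLp_map_measure_iff hL.aestronglyMeasurable hTm.aemeasurable]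
    exact (memLp_congr_ae hC).2 hLp
  have hvar' : Var[L; gaussianMeasure n A]
      ≤ n * ((M / c + 1) ^ 2 * Var[fun x : ℝ => x ^ 2; gaussianReal 0 1]) := by
    rw [← hmap, variance_map hL.aemeasurable hTm.aemeasurable]
    exact (variance_congr hC).trans_le hvar
  refine ⟨?_, measureReal_le_one⟩
  set s := {x | |L x - ∫ y, L y ∂(gaussianMeasure n A)| ≤ δ} with hs
  have hsm : MeasurableSet s :=
    measurableSet_le (hL.sub_const _).abs measurable_const
  have hcompl : (gaussianMeasure n A).real sᶜ ≤ Var[L; gaussianMeasure n A] / δ ^ 2 := by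
    refine ENNReal.toReal_le_of_le_ofReal (div_nonneg (variance_nonneg _ _) (sq_nonneg _)) ?_
    refine (measure_mono fun x hx => ?_).trans (meas_ge_le_variance_div_sq hLp' hδ)
    exact (not_le.1 (show ¬|L x - _| ≤ δ from hx)).le
  have hdiv := div_le_div_of_nonneg_right hvar' (sq_nonneg δ)
  have hadd := probReal_add_probReal_compl (μ := gaussianMeasure n A) hsm
  change _ ≤ (gaussianMeasure n A).real s
  linarith

end Concentration

/-- **Existence of good typicality families for correlated Gaussian hypothesis testing.**
Let `K_p ≠ K_q` (in spectrum) be even, absolutely summable auto-covariances whose spectra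
satisfy `0 < c ≤ S_p, S_q ≤ M` on `[0,1]`, let `p⁽ⁿ⁾ = N(0, Λ_p⁽ⁿ⁾)`, `q⁽ⁿ⁾ = N(0, Λ_q⁽ⁿ⁾)`
with Toeplitz covariances, and `D_n = ∫ ln (dp⁽ⁿ⁾/dq⁽ⁿ⁾) dp⁽ⁿ⁾` their relative entropy (in
nats). Then for every sequence of positive reals `δ_n` with `δ_n / √n → ∞`, the
`p⁽ⁿ⁾`-probability of the relative-entropy `δ_n`-typical set tends to `1`. -/
theorem correlated_gaussian_good_families
    (Kp Kq : ℤ → ℝ)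
    (hKp_even : ∀ m, Kp (-m) = Kp m) (hKq_even : ∀ m, Kq (-m) = Kq m)
    (hKp_sum : Summable fun m : ℤ => |Kp m|) (hKq_sum : Summable fun m : ℤ => |Kq m|)
    (c M : ℝ) (hc : 0 < c) (hcM : c ≤ M)
    (hSp : ∀ f ∈ Set.Icc (0 : ℝ) 1, c ≤ spectrum' Kp f ∧ spectrum' Kp f ≤ M)
    (hSq : ∀ f ∈ Set.Icc (0 : ℝ) 1, c ≤ spectrum' Kq f ∧ spectrum' Kq f ≤ M)
    (hne : ∃ f ∈ Set.Icc (0 : ℝ) 1, spectrum' Kp f ≠ spectrum' Kq f)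
    (D : ℕ → ℝ)
    (hD : ∀ n, D n = ∫ x, Real.log (((gaussianMeasure n (toeplitz Kp n)).rnDeriv
        (gaussianMeasure n (toeplitz Kq n)) x).toReal) ∂(gaussianMeasure n (toeplitz Kp n)))
    (δ : ℕ → ℝ) (hδ : ∀ n, 0 < δ n)
    (hδgrow : Tendsto (fun n : ℕ => δ n / Real.sqrt (n : ℝ)) atTop atTop) :
    Tendsto (fun n : ℕ =>
        ((gaussianMeasure n (toeplitz Kp n))
          {x | |Real.log (((gaussianMeasure n (toeplitz Kp n)).rnDeriv
                  (gaussianMeasure n (toeplitz Kq n)) x).toReal) - D n| ≤ δ n}).toReal)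
      atTop (nhds 1) := by
  have hM : 0 < M := hc.trans_le hcM
  set V : ℝ := (M / c + 1) ^ 2 * Var[fun x : ℝ => x ^ 2; gaussianReal 0 1]
  have hbound (n : ℕ) := measure_abs_log_rnDeriv_sub_integral_le
    (toeplitz_isSymm hKp_even n) (toeplitz_isSymm hKq_even n) hc hM
    (fun x => (dotProduct_toeplitz_mulVec_mem_Icc hKp_sum hKp_even hSp x).1)
    (fun x => (dotProduct_toeplitz_mulVec_mem_Icc hKp_sum hKp_even hSp x).2)
    (fun x => (dotProduct_toeplitz_mulVec_mem_Icc hKq_sum hKq_even hSq x).1) (hδ n)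
  simp only [← hD] at hbound
  have hlim : Tendsto (fun n : ℕ => 1 - n * V / δ n ^ 2) atTop (nhds 1) := by
    have h := ((hδgrow.inv_tendsto_atTop.pow 2).mul_const V).const_sub 1
    simp only [zero_pow two_ne_zero, zero_mul, sub_zero] at h
    refine h.congr fun n => ?_
    rw [Pi.inv_apply, inv_div, div_pow, Real.sq_sqrt (Nat.cast_nonneg n)]
    ring
  exact tendsto_of_tendsto_of_tendsto_of_le_of_le hlim tendsto_const_nhds
    (fun n => (hbound n).1) fun n => (hbound n).2
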